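/- Let n be an even positive integer and λ_n the Lebesgue function at the Morrow–Patterson points. Then for all (x,y) ∈ [−√3/2, √3/2]² one has λ_n(x,y) ≤ 4·C_n·(n+1)³·(n/2+1); in particular λ_n(x,y) = O(n²) on this sub-square. -/

import Mathlib

open Real Finset

/-- Chebyshev polynomial of the second kind, evaluated at a real number. -/
noncomputable def chebU (j : ℕ) (x : ℝ) : ℝ := (Polynomial.Chebyshev.U ℝ (j : ℤ)).eval x

/-- Angles `w_m = mπ/(n+2)` of the Morrow–Patterson points. -/
noncomputable def mpW (n m : ℕ) : ℝ := m * π / (n + 2)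

/-- Angles `v_k` of the Morrow–Patterson points (depending on the parity of `m`). -/
noncomputable def mpV (n m k : ℕ) : ℝ :=
  if Odd m then 2 * k * π / (n + 3) else (2 * k - 1) * π / (n + 3)

/-- The Lebesgue function of the Morrow–Patterson points `MP_n`. -/
noncomputable def lambdaMP (n : ℕ) (x y : ℝ) : ℝ :=
  (8 / ((n + 2) * (n + 3))) *
    ∑ m ∈ Finset.Icc 1 (n + 1), ∑ k ∈ Finset.Icc 1 (n / 2 + 1),
      (1 - Real.cos (mpW n m) ^ 2) * (1 - Real.cos (mpV n m k) ^ 2) *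
        |∑ i ∈ Finset.range (n + 1), ∑ j ∈ Finset.range (n - i + 1),
            chebU i (Real.cos (mpW n m)) * chebU j (Real.cos (mpV n m k)) *
              chebU i x * chebU j y|

lemma chebU_sq (j : ℕ) (t : ℝ) : (1 - cos t ^ 2) * chebU j (cos t) ^ 2 ≤ 1 := by
  have h := Polynomial.Chebyshev.U_real_cos t (j : ℤ)
  have h2 : (1 - cos t ^ 2) * chebU j (cos t) ^ 2 = (chebU j (cos t) * sin t) ^ 2 := by
    rw [← sin_sq]; ring
  rw [h2]
  unfold chebU
  rw [h]
  exact sin_sq_le_one _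

lemma weight_chebU (j : ℕ) (t : ℝ) : (1 - cos t ^ 2) * |chebU j (cos t)| ≤ 1 := by
  have h := chebU_sq j t
  have h0 : 0 ≤ 1 - cos t ^ 2 := by rw [← sin_sq]; positivity
  have h1 : 1 - cos t ^ 2 ≤ 1 := by nlinarith [sq_nonneg (cos t)]
  have h3 : ((1 - cos t ^ 2) * |chebU j (cos t)|) ^ 2 ≤ 1 := by
    rw [mul_pow, sq_abs]
    nlinarith
  exact (sq_le_one_iff₀ (by positivity)).1 h3

lemma chebU_le_two (j : ℕ) (x : ℝ)
    (hx : x ∈ Set.Icc (-(Real.sqrt 3 / 2)) (Real.sqrt 3 / 2)) : |chebU j x| ≤ 2 := by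
  have h3 : Real.sqrt 3 ^ 2 = 3 := Real.sq_sqrt (by norm_num)
  have hx2 : x ^ 2 ≤ 3 / 4 := by nlinarith [hx.1, hx.2]
  have hc : cos (arccos x) = x := cos_arccos (by nlinarith) (by nlinarith)
  have h := chebU_sq j (arccos x)
  rw [hc] at h
  refine abs_le_of_sq_le_sq ?_ (by norm_num)
  nlinarith [sq_nonneg (chebU j x)]

lemma term_le (n : ℕ) (s t x y : ℝ)
    (hx : x ∈ Set.Icc (-(Real.sqrt 3 / 2)) (Real.sqrt 3 / 2))
    (hy : y ∈ Set.Icc (-(Real.sqrt 3 / 2)) (Real.sqrt 3 / 2)) :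
    (1 - cos s ^ 2) * (1 - cos t ^ 2) *
        |∑ i ∈ Finset.range (n + 1), ∑ j ∈ Finset.range (n - i + 1),
            chebU i (cos s) * chebU j (cos t) * chebU i x * chebU j y|
      ≤ 4 * ((n : ℝ) + 1) ^ 2 := by
  have hs0 : 0 ≤ 1 - cos s ^ 2 := by rw [← sin_sq]; positivity
  have ht0 : 0 ≤ 1 - cos t ^ 2 := by rw [← sin_sq]; positivity
  have key : ∀ i j : ℕ, (1 - cos s ^ 2) * (1 - cos t ^ 2) *
      |chebU i (cos s) * chebU j (cos t) * chebU i x * chebU j y| ≤ 4 := by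
    intro i j
    have e : (1 - cos s ^ 2) * (1 - cos t ^ 2) *
      |chebU i (cos s) * chebU j (cos t) * chebU i x * chebU j y| =
      (((1 - cos s ^ 2) * |chebU i (cos s)|) * ((1 - cos t ^ 2) * |chebU j (cos t)|)) *
        (|chebU i x| * |chebU j y|) := by
      simp only [abs_mul]; ring
    rw [e]
    calc _ ≤ (1 * 1) * ((2 : ℝ) * 2) := by
          gcongr
          · exact weight_chebU i s
          · exact weight_chebU j t
          · exact chebU_le_two i x hx
          · exact chebU_le_two j y hy
      _ = 4 := by norm_num
  calc _ ≤ (1 - cos s ^ 2) * (1 - cos t ^ 2) *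
        ∑ i ∈ Finset.range (n + 1), ∑ j ∈ Finset.range (n - i + 1),
            |chebU i (cos s) * chebU j (cos t) * chebU i x * chebU j y| := by
        gcongr
        refine (Finset.abs_sum_le_sum_abs _ _).trans ?_
        gcongr
        exact Finset.abs_sum_le_sum_abs _ _
    _ = ∑ i ∈ Finset.range (n + 1), ∑ j ∈ Finset.range (n - i + 1),
          (1 - cos s ^ 2) * (1 - cos t ^ 2) *
            |chebU i (cos s) * chebU j (cos t) * chebU i x * chebU j y| := by
        simp only [Finset.mul_sum]
    _ ≤ ∑ i ∈ Finset.range (n + 1), ∑ j ∈ Finset.range (n - i + 1), (4 : ℝ) := by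
        gcongr
        exact key _ _
    _ ≤ ∑ i ∈ Finset.range (n + 1), ((n : ℝ) + 1) * 4 := by
        gcongr with i hi
        rw [Finset.sum_const, Finset.card_range, nsmul_eq_mul]
        have : n - i ≤ n := Nat.sub_le _ _
        have h : ((n - i : ℕ) : ℝ) ≤ n := by exact_mod_cast this
        push_cast
        linarith
    _ = 4 * ((n : ℝ) + 1) ^ 2 := by
        rw [Finset.sum_const, Finset.card_range, nsmul_eq_mul]
        push_cast
        ring

/-- On the sub-square `[-√3/2, √3/2]²` the Lebesgue function of the Morrow–Patterson
points satisfies `λ_n(x,y) ≤ 4 C_n (n+1)³ (n/2+1)`, where `C_n = 8/((n+2)(n+3))`;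
in particular `λ_n = O(n²)` there. -/
theorem lambdaMP_le_on_subsquare (n : ℕ) (hn : 0 < n) (hne : Even n)
    (x : ℝ) (hx : x ∈ Set.Icc (-(Real.sqrt 3 / 2)) (Real.sqrt 3 / 2))
    (y : ℝ) (hy : y ∈ Set.Icc (-(Real.sqrt 3 / 2)) (Real.sqrt 3 / 2)) :
    lambdaMP n x y ≤
      4 * (8 / (((n : ℝ) + 2) * ((n : ℝ) + 3))) * ((n : ℝ) + 1) ^ 3 * ((n : ℝ) / 2 + 1) := by
  unfold lambdaMP
  obtain ⟨r, rfl⟩ := hne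
  have hd : (r + r) / 2 = r := by omega
  calc _ ≤ (8 / (((r + r : ℕ) : ℝ) + 2) / (((r + r : ℕ) : ℝ) + 3)) *
        ∑ m ∈ Finset.Icc 1 (r + r + 1), ∑ k ∈ Finset.Icc 1 ((r + r) / 2 + 1),
          4 * (((r + r : ℕ) : ℝ) + 1) ^ 2 := by
        rw [div_div]
        refine mul_le_mul_of_nonneg_left ?_ (by positivity)
        refine Finset.sum_le_sum fun m _ => Finset.sum_le_sum fun k _ => ?_
        exact term_le _ _ _ x y hx hy
    _ = _ := by
        simp only [Finset.sum_const, Nat.card_Icc, nsmul_eq_mul, hd, Nat.add_sub_cancel]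
        push_cast
        rw [div_div]
        ring
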